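/- For every Inclusion Logic sentence φ there exists a Positive Greatest Fixed Point Logic sentence θ over the same signature such that for all structures M: M ⊨ φ if and only if M ⊨ θ. -/

import Mathlib

open FirstOrder Language Set

namespace TeamSem

/-- The set of variables occurring in a term. -/
def tvars {L : Language} : L.Term ℕ → Set ℕ
  | Term.var v => {v}
  | Term.func _ ts => ⋃ i, tvars (ts i)

/-- Formulas of Inclusion Logic FO(⊆) in negation normal form, over the signature `L`,
with variables from `ℕ`. -/
inductive IncForm (L : Language) where
  | rel {n : ℕ} (R : L.Relations n) (ts : Fin n → L.Term ℕ)
  | nrel {n : ℕ} (R : L.Relations n) (ts : Fin n → L.Term ℕ)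
  | eq (t u : L.Term ℕ)
  | neq (t u : L.Term ℕ)
  | incl {k : ℕ} (ts us : Fin k → L.Term ℕ)
  | and (φ ψ : IncForm L)
  | or (φ ψ : IncForm L)
  | ex (v : ℕ) (φ : IncForm L)
  | all (v : ℕ) (φ : IncForm L)

variable {L : Language}

/-- The supplemented team `X[H/v]`. -/
def suppTeam {M : Type*} (X : Set (ℕ → M)) (H : (ℕ → M) → Set M) (v : ℕ) : Set (ℕ → M) :=
  {t | ∃ s ∈ X, ∃ m ∈ H s, t = Function.update s v m}

/-- The duplicated team `X[M/v]`. -/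
def dupTeam (M : Type*) (X : Set (ℕ → M)) (v : ℕ) : Set (ℕ → M) :=
  {t | ∃ s ∈ X, ∃ m : M, t = Function.update s v m}

/-- Lax team semantics for Inclusion Logic: `teamSat M φ X` says `M ⊨_X φ`. -/
def teamSat (M : Type*) [L.Structure M] : IncForm L → Set (ℕ → M) → Prop
  | .rel R ts, X => ∀ s ∈ X, Structure.RelMap R fun i => (ts i).realize s
  | .nrel R ts, X => ∀ s ∈ X, ¬ Structure.RelMap R fun i => (ts i).realize s
  | .eq t u, X => ∀ s ∈ X, t.realize s = u.realize s
  | .neq t u, X => ∀ s ∈ X, t.realize s ≠ u.realize s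
  | .incl ts us, X => ∀ s ∈ X, ∃ s' ∈ X, ∀ i, (ts i).realize s = (us i).realize s'
  | .and φ ψ, X => teamSat M φ X ∧ teamSat M ψ X
  | .or φ ψ, X => ∃ Y Z, X = Y ∪ Z ∧ teamSat M φ Y ∧ teamSat M ψ Z
  | .ex v φ, X => ∃ H : (ℕ → M) → Set M, (∀ s ∈ X, (H s).Nonempty) ∧
      teamSat M φ (suppTeam X H v)
  | .all v φ, X => teamSat M φ (dupTeam M X v)

/-- Free variables of an Inclusion Logic formula. -/
def fvInc : IncForm L → Set ℕ
  | .rel _ ts => ⋃ i, tvars (ts i)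
  | .nrel _ ts => ⋃ i, tvars (ts i)
  | .eq t u => tvars t ∪ tvars u
  | .neq t u => tvars t ∪ tvars u
  | .incl ts us => (⋃ i, tvars (ts i)) ∪ ⋃ i, tvars (us i)
  | .and φ ψ => fvInc φ ∪ fvInc ψ
  | .or φ ψ => fvInc φ ∪ fvInc ψ
  | .ex v φ => fvInc φ \ {v}
  | .all v φ => fvInc φ \ {v}

/-- Truth of an FO(⊆) sentence in a model: satisfaction by the team consisting of the
empty assignment (encoded, with total assignments, as the singleton team `{s}` for
every `s`; for sentences all these coincide). -/
def incTrue (M : Type*) [L.Structure M] (φ : IncForm L) : Prop :=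
  ∀ s : ℕ → M, teamSat M φ {s}

/-- The relation `X(x̄)` of values of a team, for `x̄ = (x_0, …, x_{n-1})` where we use
the variables `0, …, n-1` for `x₁, …, xₙ`. -/
def teamRel (n : ℕ) {M : Type*} (X : Set (ℕ → M)) : Set (Fin n → M) :=
  {a | ∃ s ∈ X, a = fun j : Fin n => s (j : ℕ)}

end TeamSem

namespace TeamSem

/-- Interpretations of second-order relation variables: relation variable number `i`
of arity `k` is interpreted as `I k i`. -/
def RelInterp (M : Type*) : Type _ := (k : ℕ) → ℕ → Set (Fin k → M)

/-- The trivial interpretation (all relation variables empty). -/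
def botI (M : Type*) : RelInterp M := fun _ _ => ∅

/-- Update the interpretation of relation variable `i` of arity `n` to `Q`. -/
def updI {M : Type*} (I : RelInterp M) (n i : ℕ) (Q : Set (Fin n → M)) : RelInterp M :=
  fun k j => {a | if h : k = n ∧ j = i then (fun m => a (Fin.cast h.1.symm m)) ∈ Q else a ∈ I k j}

/-- Simultaneous update of an assignment on the variables `xs` by the tuple `a`. -/
noncomputable def updVec {M : Type*} (s : ℕ → M) {n : ℕ} (xs : Fin n → ℕ)
    (a : Fin n → M) : ℕ → M :=
  fun v => if h : ∃ j, xs j = v then a h.choose else s v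

/-- Formulas of Positive Greatest Fixed Point Logic (PGFP) in negation normal form:
second-order relation variables (`rvar i`, of arity `n`) and the `gfp` operator can occur
only positively (there are no negated `rvar`/`gfp` constructors). -/
inductive GFPForm (L : Language) where
  | rel {n : ℕ} (R : L.Relations n) (ts : Fin n → L.Term ℕ)
  | nrel {n : ℕ} (R : L.Relations n) (ts : Fin n → L.Term ℕ)
  | eq (t u : L.Term ℕ)
  | neq (t u : L.Term ℕ)
  | rvar (i : ℕ) {n : ℕ} (ts : Fin n → L.Term ℕ)
  | and (φ ψ : GFPForm L)
  | or (φ ψ : GFPForm L)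
  | ex (v : ℕ) (φ : GFPForm L)
  | all (v : ℕ) (φ : GFPForm L)
  | gfp (i n : ℕ) (xs : Fin n → ℕ) (φ : GFPForm L) (ts : Fin n → L.Term ℕ)

variable {L : Language}

/-- Tarski semantics for PGFP.  The clause for `gfp i n xs φ ts` uses the Knaster–Tarski
characterization: the greatest fixed point of the monotone operator
`Γ(Q) = {ā | (M, Q/i) ⊨ φ(ā)}` equals `⋃ {Q | Q ⊆ Γ(Q)}`. -/
def gsat (M : Type*) [L.Structure M] : GFPForm L → RelInterp M → (ℕ → M) → Prop
  | .rel R ts, _, s => Structure.RelMap R fun i => (ts i).realize s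
  | .nrel R ts, _, s => ¬ Structure.RelMap R fun i => (ts i).realize s
  | .eq t u, _, s => t.realize s = u.realize s
  | .neq t u, _, s => t.realize s ≠ u.realize s
  | .rvar i ts, I, s => (fun j => (ts j).realize s) ∈ I _ i
  | .and φ ψ, I, s => gsat M φ I s ∧ gsat M ψ I s
  | .or φ ψ, I, s => gsat M φ I s ∨ gsat M ψ I s
  | .ex v φ, I, s => ∃ m : M, gsat M φ I (Function.update s v m)
  | .all v φ, I, s => ∀ m : M, gsat M φ I (Function.update s v m)
  | .gfp i n xs φ ts, I, s =>
      (fun j => (ts j).realize s) ∈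
        ⋃₀ {Q : Set (Fin n → M) | Q ⊆ {a | gsat M φ (updI I n i Q) (updVec s xs a)}}

/-- Free first-order variables of a PGFP formula. -/
def fvG : GFPForm L → Set ℕ
  | .rel _ ts => ⋃ i, tvars (ts i)
  | .nrel _ ts => ⋃ i, tvars (ts i)
  | .eq t u => tvars t ∪ tvars u
  | .neq t u => tvars t ∪ tvars u
  | .rvar _ ts => ⋃ i, tvars (ts i)
  | .and φ ψ => fvG φ ∪ fvG ψ
  | .or φ ψ => fvG φ ∪ fvG ψ
  | .ex v φ => fvG φ \ {v}
  | .all v φ => fvG φ \ {v}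
  | .gfp _ _ xs φ ts => (⋃ i, tvars (ts i)) ∪ (fvG φ \ Set.range fun j => xs j)

/-- All first-order variables (free or bound) occurring in a PGFP formula. -/
def avG : GFPForm L → Set ℕ
  | .rel _ ts => ⋃ i, tvars (ts i)
  | .nrel _ ts => ⋃ i, tvars (ts i)
  | .eq t u => tvars t ∪ tvars u
  | .neq t u => tvars t ∪ tvars u
  | .rvar _ ts => ⋃ i, tvars (ts i)
  | .and φ ψ => avG φ ∪ avG ψ
  | .or φ ψ => avG φ ∪ avG ψ
  | .ex v φ => {v} ∪ avG φ
  | .all v φ => {v} ∪ avG φ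
  | .gfp _ _ xs φ ts => (⋃ i, tvars (ts i)) ∪ (Set.range fun j => xs j) ∪ avG φ

/-- Free relation variables of a PGFP formula, together with their arities. -/
def rvG : GFPForm L → Set (ℕ × ℕ)
  | @GFPForm.rvar _ i n _ => {(i, n)}
  | .and φ ψ => rvG φ ∪ rvG ψ
  | .or φ ψ => rvG φ ∪ rvG ψ
  | .ex _ φ => rvG φ
  | .all _ φ => rvG φ
  | .gfp i n _ φ _ => rvG φ \ {(i, n)}
  | _ => ∅

/-- PGFP formulas containing no `gfp` operator, i.e. first-order formulas
(possibly mentioning relation variables positively). -/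
def NoGfp : GFPForm L → Prop
  | .and φ ψ => NoGfp φ ∧ NoGfp ψ
  | .or φ ψ => NoGfp φ ∧ NoGfp ψ
  | .ex _ φ => NoGfp φ
  | .all _ φ => NoGfp φ
  | .gfp .. => False
  | _ => True

end TeamSem

namespace TeamSem

variable {L : Language}

/-! ### Variables -/

lemma finite_tvars (t : L.Term ℕ) : (tvars t).Finite := by
  induction t with
  | var v => exact Set.finite_singleton v
  | func f ts ih => exact Set.finite_iUnion ih

lemma realize_congr {M : Type*} [L.Structure M] (t : L.Term ℕ) {s s' : ℕ → M}
    (h : ∀ v ∈ tvars t, s v = s' v) : t.realize s = t.realize s' := by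
  induction t with
  | var v => exact h v rfl
  | func f ts ih =>
    simp only [Term.realize_func]
    congr 1
    funext i
    exact ih i fun v hv => h v (Set.mem_iUnion.2 ⟨i, hv⟩)

lemma tvars_relabel (g : ℕ → ℕ) (t : L.Term ℕ) : tvars (t.relabel g) = g '' tvars t := by
  induction t with
  | var v => simp [tvars, Term.relabel]
  | func f ts ih => simp [tvars, Term.relabel, ih, Set.image_iUnion]

/-- All variables, free or bound, of an Inclusion Logic formula. -/
def avInc : IncForm L → Set ℕ
  | .rel _ ts => ⋃ i, tvars (ts i)
  | .nrel _ ts => ⋃ i, tvars (ts i)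
  | .eq t u => tvars t ∪ tvars u
  | .neq t u => tvars t ∪ tvars u
  | .incl ts us => (⋃ i, tvars (ts i)) ∪ ⋃ i, tvars (us i)
  | .and φ ψ => avInc φ ∪ avInc ψ
  | .or φ ψ => avInc φ ∪ avInc ψ
  | .ex v φ => {v} ∪ avInc φ
  | .all v φ => {v} ∪ avInc φ

lemma finite_avInc (φ : IncForm L) : (avInc φ).Finite := by
  induction φ with
  | rel R ts => exact Set.finite_iUnion fun i => finite_tvars _
  | nrel R ts => exact Set.finite_iUnion fun i => finite_tvars _
  | eq t u => exact (finite_tvars t).union (finite_tvars u)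
  | neq t u => exact (finite_tvars t).union (finite_tvars u)
  | incl ts us =>
    exact (Set.finite_iUnion fun i => finite_tvars _).union
      (Set.finite_iUnion fun i => finite_tvars _)
  | and φ ψ hφ hψ => exact hφ.union hψ
  | or φ ψ hφ hψ => exact hφ.union hψ
  | ex v φ h => exact (Set.finite_singleton v).union h
  | all v φ h => exact (Set.finite_singleton v).union h

lemma gsat_congr {M : Type*} [L.Structure M] (φ : GFPForm L) (I : RelInterp M) {s s' : ℕ → M}
    (h : ∀ v ∈ fvG φ, s v = s' v) : gsat M φ I s ↔ gsat M φ I s' := by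
  have upd : ∀ (φ : GFPForm L) {s s' : ℕ → M} (v : ℕ) (m : M),
      (∀ w ∈ fvG φ \ {v}, s w = s' w) →
      ∀ w ∈ fvG φ, Function.update s v m w = Function.update s' v m w := by
    intro φ s s' v m h w hw
    by_cases hwv : w = v
    · subst hwv; simp
    · simp [hwv, h w ⟨hw, hwv⟩]
  have terms : ∀ {n : ℕ} (ts : Fin n → L.Term ℕ) {s s' : ℕ → M},
      (∀ v ∈ ⋃ i, tvars (ts i), s v = s' v) →
      (fun i => (ts i).realize s) = fun i => (ts i).realize s' := fun ts s s' h =>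
    funext fun i => realize_congr _ fun v hv => h v (Set.mem_iUnion.2 ⟨i, hv⟩)
  induction φ generalizing I s s' with
  | rel R ts => simp only [gsat, terms ts h]
  | nrel R ts => simp only [gsat, terms ts h]
  | eq t u =>
    simp only [gsat, realize_congr t fun v hv => h v (Or.inl hv),
      realize_congr u fun v hv => h v (Or.inr hv)]
  | neq t u =>
    simp only [gsat, realize_congr t fun v hv => h v (Or.inl hv),
      realize_congr u fun v hv => h v (Or.inr hv)]
  | rvar i ts => simp only [gsat, terms ts h]
  | and φ ψ hφ hψ =>
    exact and_congr (hφ I fun v hv => h v (Or.inl hv)) (hψ I fun v hv => h v (Or.inr hv))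
  | or φ ψ hφ hψ =>
    exact or_congr (hφ I fun v hv => h v (Or.inl hv)) (hψ I fun v hv => h v (Or.inr hv))
  | ex v φ ih => exact exists_congr fun m => ih I (upd φ v m h)
  | all v φ ih => exact forall_congr' fun m => ih I (upd φ v m h)
  | gfp i n xs φ ts ih =>
    simp only [gsat, terms ts fun v hv => h v (Or.inl hv)]
    have key : ∀ Q a, gsat M φ (updI I n i Q) (updVec s xs a) ↔
        gsat M φ (updI I n i Q) (updVec s' xs a) := by
      refine fun Q a => ih _ fun v hv => ?_
      unfold updVec
      split_ifs with hx
      · rfl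
      · exact h v (Or.inr ⟨hv, hx⟩)
    simp only [key]

/-! ### Union closure -/

/-- Inclusion Logic formulas are closed under arbitrary unions of teams. -/
lemma teamSat_sUnion {M : Type*} [L.Structure M] (φ : IncForm L) (C : Set (Set (ℕ → M)))
    (h : ∀ Y ∈ C, teamSat M φ Y) : teamSat M φ (⋃₀ C) := by
  induction φ generalizing C with
  | rel R ts => rintro s ⟨Y, hY, hs⟩; exact h Y hY s hs
  | nrel R ts => rintro s ⟨Y, hY, hs⟩; exact h Y hY s hs
  | eq t u => rintro s ⟨Y, hY, hs⟩; exact h Y hY s hs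
  | neq t u => rintro s ⟨Y, hY, hs⟩; exact h Y hY s hs
  | incl ts us =>
    rintro s ⟨Y, hY, hs⟩
    obtain ⟨s', hs', e⟩ := h Y hY s hs
    exact ⟨s', ⟨Y, hY, hs'⟩, e⟩
  | and φ ψ hφ hψ => exact ⟨hφ C fun Y hY => (h Y hY).1, hψ C fun Y hY => (h Y hY).2⟩
  | or φ ψ hφ hψ =>
    choose! A B e hA hB using h
    refine ⟨⋃₀ (A '' C), ⋃₀ (B '' C), ?_, hφ _ ?_, hψ _ ?_⟩
    · ext s
      constructor
      · rintro ⟨Y, hY, hs⟩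
        rw [e Y hY] at hs
        exact hs.imp (fun h => ⟨_, ⟨Y, hY, rfl⟩, h⟩) fun h => ⟨_, ⟨Y, hY, rfl⟩, h⟩
      · rintro (⟨_, ⟨Y, hY, rfl⟩, hs⟩ | ⟨_, ⟨Y, hY, rfl⟩, hs⟩)
        · exact ⟨Y, hY, (e Y hY).symm ▸ Or.inl hs⟩
        · exact ⟨Y, hY, (e Y hY).symm ▸ Or.inr hs⟩
    · rintro _ ⟨Y, hY, rfl⟩; exact hA Y hY
    · rintro _ ⟨Y, hY, rfl⟩; exact hB Y hY
  | ex v φ ih =>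
    choose! H hne hsat using h
    refine ⟨fun s => {m | ∃ Y ∈ C, s ∈ Y ∧ m ∈ H Y s}, ?_, ?_⟩
    · rintro s ⟨Y, hY, hs⟩
      obtain ⟨m, hm⟩ := hne Y hY s hs
      exact ⟨m, Y, hY, hs, hm⟩
    · have := ih ((fun Y => suppTeam Y (H Y) v) '' C) (by
        rintro _ ⟨Y, hY, rfl⟩; exact hsat Y hY)
      convert this using 1
      ext t
      constructor
      · rintro ⟨s, -, m, ⟨Y, hY, hs, hm⟩, rfl⟩
        exact ⟨_, ⟨Y, hY, rfl⟩, s, hs, m, hm, rfl⟩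
      · rintro ⟨_, ⟨Y, hY, rfl⟩, s, hs, m, hm, rfl⟩
        exact ⟨s, ⟨Y, hY, hs⟩, m, ⟨Y, hY, hs, hm⟩, rfl⟩
  | all v φ ih =>
    have := ih ((fun Y => dupTeam M Y v) '' C) (by rintro _ ⟨Y, hY, rfl⟩; exact h Y hY)
    change teamSat M φ (dupTeam M (⋃₀ C) v)
    convert this using 1
    ext t
    constructor
    · rintro ⟨s, ⟨Y, hY, hs⟩, m, rfl⟩
      exact ⟨_, ⟨Y, hY, rfl⟩, s, hs, m, rfl⟩
    · rintro ⟨_, ⟨Y, hY, rfl⟩, s, hs, m, rfl⟩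
      exact ⟨s, ⟨Y, hY, hs⟩, m, rfl⟩

/-! ### Derived connectives of PGFP -/

/-- Block of existential quantifiers. -/
def exs (l : List ℕ) (χ : GFPForm L) : GFPForm L := l.foldr .ex χ

/-- Block of universal quantifiers. -/
def alls (l : List ℕ) (χ : GFPForm L) : GFPForm L := l.foldr .all χ

/-- The conjunction of `χ` with the equations `t m = u m` for `m` in `l`. -/
def conjEqs {k : ℕ} (t u : Fin k → L.Term ℕ) (χ : GFPForm L) (l : List (Fin k)) : GFPForm L :=
  l.foldr (fun m ξ => .and (.eq (t m) (u m)) ξ) χ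

section Derived

variable {M : Type*} [L.Structure M]

lemma gsat_exs (l : List ℕ) (χ : GFPForm L) (I : RelInterp M) (s : ℕ → M) :
    gsat M (exs l χ) I s ↔ ∃ s', (∀ v ∉ l, s' v = s v) ∧ gsat M χ I s' := by
  induction l generalizing s with
  | nil =>
    constructor
    · exact fun h => ⟨s, fun _ _ => rfl, h⟩
    · rintro ⟨s', h, h'⟩
      obtain rfl : s' = s := funext fun v => h v (by simp)
      exact h'
  | cons w l ih =>
    change (∃ m, gsat M (exs l χ) I (Function.update s w m)) ↔ _
    simp only [ih]
    constructor
    · rintro ⟨m, s', h, h'⟩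
      refine ⟨s', fun v hv => ?_, h'⟩
      rw [List.mem_cons, not_or] at hv
      rw [h v hv.2, Function.update_of_ne hv.1]
    · rintro ⟨s', h, h'⟩
      refine ⟨s' w, s', fun v hv => ?_, h'⟩
      by_cases hvw : v = w
      · subst hvw; simp
      · rw [Function.update_of_ne hvw, h v (by simp [hvw, hv])]

lemma gsat_alls (l : List ℕ) (χ : GFPForm L) (I : RelInterp M) :
    (∀ s, gsat M (alls l χ) I s) ↔ ∀ s, gsat M χ I s := by
  induction l with
  | nil => rfl
  | cons w l ih =>
    rw [← ih]
    change (∀ s m, gsat M (alls l χ) I (Function.update s w m)) ↔ _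
    exact ⟨fun h s => by simpa using h s (s w), fun h s m => h _⟩

lemma gsat_conjEqs {k : ℕ} (t u : Fin k → L.Term ℕ) (χ : GFPForm L) (l : List (Fin k))
    (I : RelInterp M) (s : ℕ → M) :
    gsat M (conjEqs t u χ l) I s ↔
      (∀ m ∈ l, (t m).realize s = (u m).realize s) ∧ gsat M χ I s := by
  induction l with
  | nil => simp [conjEqs]
  | cons m l ih =>
    change (_ ∧ gsat M (conjEqs t u χ l) I s) ↔ _
    rw [ih, List.forall_mem_cons, and_assoc]
    rfl

end Derived

lemma fvG_exs (l : List ℕ) (χ : GFPForm L) : fvG (exs l χ) = fvG χ \ {v | v ∈ l} := by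
  induction l with
  | nil => simp [exs]
  | cons w l ih =>
    change fvG (exs l χ) \ {w} = _
    rw [ih]
    ext v
    simp
    tauto

lemma fvG_alls (l : List ℕ) (χ : GFPForm L) : fvG (alls l χ) = fvG χ \ {v | v ∈ l} := by
  induction l with
  | nil => simp [alls]
  | cons w l ih =>
    change fvG (alls l χ) \ {w} = _
    rw [ih]
    ext v
    simp
    tauto

lemma fvG_conjEqs_subset {k : ℕ} {t u : Fin k → L.Term ℕ} {χ : GFPForm L} {S : Set ℕ}
    (ht : ∀ m, tvars (t m) ⊆ S) (hu : ∀ m, tvars (u m) ⊆ S) (hχ : fvG χ ⊆ S)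
    (l : List (Fin k)) : fvG (conjEqs t u χ l) ⊆ S := by
  induction l with
  | nil => exact hχ
  | cons m l ih => exact Set.union_subset (Set.union_subset (ht m) (hu m)) ih

lemma rvG_exs (l : List ℕ) (χ : GFPForm L) : rvG (exs l χ) = rvG χ := by
  induction l with
  | nil => rfl
  | cons w l ih => exact ih

lemma rvG_alls (l : List ℕ) (χ : GFPForm L) : rvG (alls l χ) = rvG χ := by
  induction l with
  | nil => rfl
  | cons w l ih => exact ih

lemma rvG_conjEqs {k : ℕ} (t u : Fin k → L.Term ℕ) (χ : GFPForm L) (l : List (Fin k)) :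
    rvG (conjEqs t u χ l) = rvG χ := by
  induction l with
  | nil => rfl
  | cons m l ih => exact (Set.empty_union _).trans ih

/-! ### The translation -/

/-- The atom `Rᵢ x₀ … x_{N-1}`. -/
def teamAtom (L : Language) (N i : ℕ) : GFPForm L :=
  .rvar i fun j : Fin N => Term.var (j : ℕ)

/-- `[gfp_{Rᵢ, x̄} (χ ∧ ψ)] x̄`, saying that `x̄` lies in a team inside `χ` that satisfies `ψ`. -/
def subteam (N i : ℕ) (χ ψ : GFPForm L) : GFPForm L :=
  .gfp i N (fun j => (j : ℕ)) (.and χ ψ) fun j => Term.var (j : ℕ)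

/-- Translation of an Inclusion Logic formula with variables below `N` into a PGFP formula, in
which the relation variable `i` stands for the current team. -/
def toGFP (N : ℕ) : ℕ → IncForm L → GFPForm L
  | _, .rel R ts => .rel R ts
  | _, .nrel R ts => .nrel R ts
  | _, .eq t u => .eq t u
  | _, .neq t u => .neq t u
  | i, @IncForm.incl _ k ts us =>
      exs (List.range' N N) (conjEqs ts (fun m => (us m).relabel (· + N))
        (.rvar i fun j : Fin N => Term.var (j + N)) (List.finRange k))
  | i, .and φ ψ => .and (toGFP N i φ) (toGFP N i ψ)
  | i, .or φ ψ => .or (subteam N (i + 1) (teamAtom L N i) (toGFP N (i + 1) φ))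
      (subteam N (i + 1) (teamAtom L N i) (toGFP N (i + 1) ψ))
  | i, .ex v φ => .ex v (subteam N (i + 1) (.ex v (teamAtom L N i)) (toGFP N (i + 1) φ))
  | i, .all v φ => .all v (subteam N (i + 1) (.ex v (teamAtom L N i)) (toGFP N (i + 1) φ))

lemma fvG_teamAtom (N i : ℕ) : fvG (teamAtom L N i) ⊆ Set.Iio N := by
  refine Set.iUnion_subset fun j => ?_
  rintro v rfl
  exact j.2

lemma fvG_subteam {N i : ℕ} {χ ψ : GFPForm L} (hχ : fvG χ ⊆ Set.Iio N)
    (hψ : fvG ψ ⊆ Set.Iio N) : fvG (subteam N i χ ψ) ⊆ Set.Iio N :=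
  Set.union_subset (fvG_teamAtom (L := L) N i)
    (Set.sdiff_subset.trans (Set.union_subset hχ hψ))

lemma fvG_toGFP (N i : ℕ) (φ : IncForm L) (hφ : avInc φ ⊆ Set.Iio N) :
    fvG (toGFP N i φ) ⊆ Set.Iio N := by
  induction φ generalizing i with
  | rel R ts => exact hφ
  | nrel R ts => exact hφ
  | eq t u => exact hφ
  | neq t u => exact hφ
  | incl ts us =>
    obtain ⟨h₁, h₂⟩ := Set.union_subset_iff.1 hφ
    rw [toGFP, fvG_exs, Set.sdiff_subset_iff]
    refine fvG_conjEqs_subset (fun m v hv => Or.inr (h₁ (Set.mem_iUnion.2 ⟨m, hv⟩))) ?_ ?_ _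
    · intro m
      rw [tvars_relabel]
      rintro _ ⟨w, hw, rfl⟩
      have := h₂ (Set.mem_iUnion.2 ⟨m, hw⟩)
      simp only [Set.mem_Iio] at this
      left
      simp [List.mem_range'_1]
      omega
    · refine Set.iUnion_subset fun j => ?_
      rintro _ rfl
      left
      simp [List.mem_range'_1]
  | and φ ψ h₁ h₂ =>
    obtain ⟨h, h'⟩ := Set.union_subset_iff.1 hφ
    exact Set.union_subset (h₁ i h) (h₂ i h')
  | or φ ψ h₁ h₂ =>
    obtain ⟨h, h'⟩ := Set.union_subset_iff.1 hφ
    exact Set.union_subset (fvG_subteam (fvG_teamAtom _ _) (h₁ _ h))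
      (fvG_subteam (fvG_teamAtom _ _) (h₂ _ h'))
  | ex v φ ih =>
    exact Set.sdiff_subset.trans (fvG_subteam (Set.sdiff_subset.trans (fvG_teamAtom _ _))
      (ih _ (Set.union_subset_iff.1 hφ).2))
  | all v φ ih =>
    exact Set.sdiff_subset.trans (fvG_subteam (Set.sdiff_subset.trans (fvG_teamAtom _ _))
      (ih _ (Set.union_subset_iff.1 hφ).2))

lemma rvG_subteam {N i : ℕ} {χ ψ : GFPForm L} (hχ : rvG χ ⊆ {(i, N)})
    (hψ : rvG ψ ⊆ {(i + 1, N)}) : rvG (subteam N (i + 1) χ ψ) ⊆ {(i, N)} := by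
  rintro p ⟨hp | hp, hne⟩
  · exact hχ hp
  · exact absurd (hψ hp) hne

lemma rvG_toGFP (N i : ℕ) (φ : IncForm L) : rvG (toGFP N i φ) ⊆ {(i, N)} := by
  induction φ generalizing i with
  | rel R ts => exact Set.empty_subset _
  | nrel R ts => exact Set.empty_subset _
  | eq t u => exact Set.empty_subset _
  | neq t u => exact Set.empty_subset _
  | incl ts us =>
    rw [toGFP, rvG_exs, rvG_conjEqs]
    exact Set.Subset.rfl
  | and φ ψ h₁ h₂ => exact Set.union_subset (h₁ i) (h₂ i)
  | or φ ψ h₁ h₂ =>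
    exact Set.union_subset (rvG_subteam Set.Subset.rfl (h₁ _))
      (rvG_subteam Set.Subset.rfl (h₂ _))
  | ex v φ ih => exact rvG_subteam Set.Subset.rfl (ih _)
  | all v φ ih => exact rvG_subteam Set.Subset.rfl (ih _)

/-! ### Correctness of the translation -/

section Correctness

variable {M : Type*}

lemma updI_self (I : RelInterp M) (n i : ℕ) (Q : Set (Fin n → M)) : updI I n i Q n i = Q := by
  ext a
  simp [updI]

lemma updI_of_ne (I : RelInterp M) (n : ℕ) {i j : ℕ} (hj : j ≠ i) (Q : Set (Fin n → M)) :
    updI I n i Q n j = I n j := by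
  ext a
  simp [updI, hj]

lemma updVec_of_lt (s : ℕ → M) {N v : ℕ} (hv : v < N) (a : Fin N → M) :
    updVec s (fun j : Fin N => (j : ℕ)) a v = a ⟨v, hv⟩ := by
  have h : ∃ j : Fin N, (j : ℕ) = v := ⟨⟨v, hv⟩, rfl⟩
  rw [updVec, dif_pos h]
  exact congrArg a (Fin.ext h.choose_spec)

lemma updVec_of_le (s : ℕ → M) {N v : ℕ} (hv : N ≤ v) (a : Fin N → M) :
    updVec s (fun j : Fin N => (j : ℕ)) a v = s v :=
  dif_neg fun ⟨j, hj⟩ => absurd j.2 (by simp only at hj; omega)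

lemma updVec_restrict {N : ℕ} {s t : ℕ → M} (h : ∀ v, N ≤ v → s v = t v) :
    updVec s (fun j : Fin N => (j : ℕ)) (fun j : Fin N => t j) = t := by
  funext v
  rcases lt_or_ge v N with hv | hv
  · rw [updVec_of_lt _ hv]
  · rw [updVec_of_le _ hv, h v hv]

lemma restrict_updVec {N : ℕ} (s : ℕ → M) (a : Fin N → M) :
    (fun j : Fin N => updVec s (fun j : Fin N => (j : ℕ)) a j) = a :=
  funext fun j => updVec_of_lt s j.2 a

/-- The assignments that agree with `s₀` from `N` on. -/
def agreeing (N : ℕ) (s₀ : ℕ → M) : Set (ℕ → M) := {s | ∀ v, N ≤ v → s v = s₀ v}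

lemma update_mem_agreeing {N : ℕ} {s₀ s : ℕ → M} (hs : s ∈ agreeing N s₀) {v : ℕ} (hv : v < N)
    (m : M) : Function.update s v m ∈ agreeing N s₀ := fun w hw => by
  rw [Function.update_of_ne (by omega), hs w hw]

lemma restrict_mem_teamRel {N : ℕ} {s₀ s : ℕ → M} {X : Set (ℕ → M)} (hX : X ⊆ agreeing N s₀)
    (hs : s ∈ agreeing N s₀) : (fun j : Fin N => s j) ∈ teamRel N X ↔ s ∈ X := by
  constructor
  · rintro ⟨t, ht, e⟩
    convert ht
    funext v
    rcases lt_or_ge v N with hv | hv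
    · exact congrFun e ⟨v, hv⟩
    · rw [hs v hv, hX ht v hv]
  · exact fun h => ⟨s, h, rfl⟩

lemma mem_dupTeam_iff {X : Set (ℕ → M)} {v : ℕ} {t : ℕ → M} :
    t ∈ dupTeam M X v ↔ ∃ m, Function.update t v m ∈ X := by
  constructor
  · rintro ⟨s, hs, m, rfl⟩
    exact ⟨s v, by simpa using hs⟩
  · rintro ⟨m, hm⟩
    exact ⟨_, hm, t v, by simp⟩

variable [L.Structure M]

lemma gsat_teamAtom {N i : ℕ} {s₀ s : ℕ → M} {X : Set (ℕ → M)} (hX : X ⊆ agreeing N s₀)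
    {I : RelInterp M} (hI : I N i = teamRel N X) (hs : s ∈ agreeing N s₀) :
    gsat M (teamAtom L N i) I s ↔ s ∈ X := by
  rw [← restrict_mem_teamRel hX hs, ← hI]
  rfl

lemma gsat_ex_teamAtom {N i v : ℕ} (hv : v < N) {s₀ s : ℕ → M} {X : Set (ℕ → M)}
    (hX : X ⊆ agreeing N s₀) {I : RelInterp M} (hI : I N i = teamRel N X)
    (hs : s ∈ agreeing N s₀) :
    gsat M (.ex v (teamAtom L N i)) I s ↔ s ∈ dupTeam M X v := by
  rw [mem_dupTeam_iff]
  exact exists_congr fun m => gsat_teamAtom hX hI (update_mem_agreeing hs hv m)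

lemma gsat_subteam {N i : ℕ} {s₀ s : ℕ → M} {I : RelInterp M} {χ ψ : GFPForm L}
    {φ : IncForm L} {X' : Set (ℕ → M)}
    (hχ : ∀ J : RelInterp M, J N i = I N i → ∀ t ∈ agreeing N s₀, gsat M χ J t ↔ t ∈ X')
    (hψ : ∀ (J : RelInterp M) (Y : Set (ℕ → M)), Y ⊆ agreeing N s₀ →
      J N (i + 1) = teamRel N Y → (teamSat M φ Y ↔ ∀ t ∈ Y, gsat M ψ J t))
    (hs : s ∈ agreeing N s₀) :
    gsat M (subteam N (i + 1) χ ψ) I s ↔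
      ∃ Y ⊆ agreeing N s₀, s ∈ Y ∧ Y ⊆ X' ∧ teamSat M φ Y := by
  have hne : i ≠ i + 1 := by omega
  constructor
  · rintro ⟨Q, hQ, hsQ⟩
    let Y : Set (ℕ → M) := {t ∈ agreeing N s₀ | (fun j : Fin N => t j) ∈ Q}
    have hY : teamRel N Y = Q := by
      ext a
      constructor
      · rintro ⟨t, ht, rfl⟩
        exact ht.2
      · intro ha
        refine ⟨updVec s (fun j : Fin N => (j : ℕ)) a, ⟨fun v hv => ?_, ?_⟩,
          (restrict_updVec s a).symm⟩
        · rw [updVec_of_le _ hv, hs v hv]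
        · rwa [restrict_updVec]
    have hsat : ∀ t ∈ Y, gsat M χ (updI I N (i + 1) Q) t ∧ gsat M ψ (updI I N (i + 1) Q) t := by
      rintro t ⟨ht, htQ⟩
      have := hQ htQ
      rwa [Set.mem_ofPred_eq,
        updVec_restrict fun v hv => (hs v hv).trans (ht v hv).symm] at this
    refine ⟨Y, fun t ht => ht.1, ⟨hs, hsQ⟩, fun t ht => ?_, ?_⟩
    · exact (hχ _ (updI_of_ne I N hne Q) t ht.1).1 (hsat t ht).1
    · exact (hψ (updI I N (i + 1) Q) Y (fun t ht => ht.1)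
        ((updI_self I N _ Q).trans hY.symm)).2 fun t ht => (hsat t ht).2
  · rintro ⟨Y, hYA, hsY, hYX, hY⟩
    refine ⟨teamRel N Y, ?_, s, hsY, rfl⟩
    rintro _ ⟨t, ht, rfl⟩
    rw [Set.mem_ofPred_eq,
      updVec_restrict fun v hv => (hs v hv).trans (hYA ht v hv).symm]
    exact ⟨(hχ _ (updI_of_ne I N hne _) t (hYA ht)).2 (hYX ht),
      (hψ _ Y hYA (updI_self I N _ _)).1 hY t ht⟩

lemma gsat_toGFP_incl {N i k : ℕ} {ts us : Fin k → L.Term ℕ}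
    (hts : ∀ m, tvars (ts m) ⊆ Set.Iio N) (hus : ∀ m, tvars (us m) ⊆ Set.Iio N)
    {X : Set (ℕ → M)} {I : RelInterp M} (hI : I N i = teamRel N X) (s : ℕ → M) :
    gsat M (toGFP N i (.incl ts us)) I s ↔
      ∃ s' ∈ X, ∀ m, (ts m).realize s = (us m).realize s' := by
  simp only [toGFP, gsat_exs, gsat_conjEqs, gsat, hI, List.mem_finRange, true_implies,
    Term.realize_relabel, Term.realize_var]
  constructor
  · rintro ⟨r, hr, he, s', hs', e⟩
    refine ⟨s', hs', fun m => ?_⟩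
    rw [realize_congr (ts m) (s' := r), he m]
    · exact realize_congr _ fun v hv => congrFun e ⟨v, hus m hv⟩
    · intro v hv
      have : v < N := hts m hv
      refine (hr v ?_).symm
      simp [List.mem_range'_1]
      omega
  · rintro ⟨s', hs', he⟩
    refine ⟨fun v => if N ≤ v ∧ v < N + N then s' (v - N) else s v, ?_, fun m => ?_,
      s', hs', ?_⟩
    · intro v hv
      rw [List.mem_range'_1] at hv
      exact if_neg hv
    · rw [realize_congr (ts m) (s' := s), he m]
      · refine realize_congr _ fun v hv => ?_
        have : v < N := hus m hv
        simp [this]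
      · intro v hv
        have : v < N := hts m hv
        exact if_neg (by omega)
    · funext j
      simp

lemma teamSat_iff_gsat (N : ℕ) (s₀ : ℕ → M) (φ : IncForm L) (hφ : avInc φ ⊆ Set.Iio N) (i : ℕ)
    (I : RelInterp M) (X : Set (ℕ → M)) (hX : X ⊆ agreeing N s₀) (hI : I N i = teamRel N X) :
    teamSat M φ X ↔ ∀ s ∈ X, gsat M (toGFP N i φ) I s := by
  induction φ generalizing i I X with
  | rel R ts => rfl
  | nrel R ts => rfl
  | eq t u => rfl
  | neq t u => rfl
  | incl ts us =>
    obtain ⟨h₁, h₂⟩ := Set.union_subset_iff.1 hφ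
    exact forall₂_congr fun s _ =>
      (gsat_toGFP_incl (Set.iUnion_subset_iff.1 h₁) (Set.iUnion_subset_iff.1 h₂) hI s).symm
  | and φ ψ ihφ ihψ =>
    obtain ⟨h₁, h₂⟩ := Set.union_subset_iff.1 hφ
    simp only [teamSat, toGFP, gsat, ihφ h₁ i I X hX hI, ihψ h₂ i I X hX hI,
      ← forall₂_and]
  | or φ ψ ihφ ihψ =>
    obtain ⟨h₁, h₂⟩ := Set.union_subset_iff.1 hφ
    have hat : ∀ J : RelInterp M, J N i = I N i → ∀ t ∈ agreeing N s₀,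
        gsat M (teamAtom L N i) J t ↔ t ∈ X := fun J hJ t ht =>
      gsat_teamAtom hX (hJ.trans hI) ht
    have key : ∀ s ∈ X, gsat M (toGFP N i (.or φ ψ)) I s ↔
        (∃ Y ⊆ agreeing N s₀, s ∈ Y ∧ Y ⊆ X ∧ teamSat M φ Y) ∨
        ∃ Y ⊆ agreeing N s₀, s ∈ Y ∧ Y ⊆ X ∧ teamSat M ψ Y := fun s hs =>
      or_congr (gsat_subteam hat (fun J Y => ihφ h₁ (i + 1) J Y) (hX hs))
        (gsat_subteam hat (fun J Y => ihψ h₂ (i + 1) J Y) (hX hs))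
    rw [forall₂_congr key]
    constructor
    · rintro ⟨Y, Z, rfl, hY, hZ⟩ s (hs | hs)
      · exact Or.inl ⟨Y, Set.subset_union_left.trans hX, hs, Set.subset_union_left, hY⟩
      · exact Or.inr ⟨Z, Set.subset_union_right.trans hX, hs, Set.subset_union_right, hZ⟩
    · intro h
      refine ⟨⋃₀ {Y | Y ⊆ X ∧ teamSat M φ Y}, ⋃₀ {Y | Y ⊆ X ∧ teamSat M ψ Y}, ?_,
        teamSat_sUnion _ _ fun Y hY => hY.2, teamSat_sUnion _ _ fun Y hY => hY.2⟩
      refine Set.Subset.antisymm (fun s hs => ?_)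
        (Set.union_subset (Set.sUnion_subset fun Y hY => hY.1)
          (Set.sUnion_subset fun Y hY => hY.1))
      rcases h s hs with ⟨Y, -, hsY, hY⟩ | ⟨Y, -, hsY, hY⟩
      · exact Or.inl ⟨Y, hY, hsY⟩
      · exact Or.inr ⟨Y, hY, hsY⟩
  | ex v φ ih =>
    obtain ⟨hv, h₁⟩ := Set.union_subset_iff.1 hφ
    have hv : v < N := hv rfl
    have key : ∀ s ∈ X, gsat M (toGFP N i (.ex v φ)) I s ↔
        ∃ m, ∃ Y ⊆ agreeing N s₀, Function.update s v m ∈ Y ∧ Y ⊆ dupTeam M X v ∧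
          teamSat M φ Y := fun s hs => exists_congr fun m =>
      gsat_subteam (fun J hJ t ht => gsat_ex_teamAtom hv hX (hJ.trans hI) ht)
        (fun J Y => ih h₁ (i + 1) J Y) (update_mem_agreeing (hX hs) hv m)
    rw [forall₂_congr key]
    constructor
    · rintro ⟨H, hH, hsat⟩ s hs
      obtain ⟨m, hm⟩ := hH s hs
      refine ⟨m, suppTeam X H v, ?_, ⟨s, hs, m, hm, rfl⟩, ?_, hsat⟩
      · rintro _ ⟨t, ht, m, -, rfl⟩
        exact update_mem_agreeing (hX ht) hv m
      · rintro _ ⟨t, ht, m, -, rfl⟩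
        exact ⟨t, ht, m, rfl⟩
    · intro h
      let C : Set (Set (ℕ → M)) := {Y | Y ⊆ dupTeam M X v ∧ teamSat M φ Y}
      refine ⟨fun s => {m | Function.update s v m ∈ ⋃₀ C}, fun s hs => ?_, ?_⟩
      · obtain ⟨m, Y, -, hm, hY⟩ := h s hs
        exact ⟨m, Y, hY, hm⟩
      · convert teamSat_sUnion φ C fun Y hY => hY.2 using 1
        refine Set.Subset.antisymm ?_ fun t ht => ?_
        · rintro _ ⟨s, hs, m, hm, rfl⟩
          exact hm
        · obtain ⟨Y, hY, htY⟩ := id ht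
          obtain ⟨s, hs, m, rfl⟩ := hY.1 htY
          exact ⟨s, hs, m, ht, rfl⟩
  | all v φ ih =>
    obtain ⟨hv, h₁⟩ := Set.union_subset_iff.1 hφ
    have hv : v < N := hv rfl
    have key : ∀ s ∈ X, gsat M (toGFP N i (.all v φ)) I s ↔
        ∀ m, ∃ Y ⊆ agreeing N s₀, Function.update s v m ∈ Y ∧ Y ⊆ dupTeam M X v ∧
          teamSat M φ Y := fun s hs => forall_congr' fun m =>
      gsat_subteam (fun J hJ t ht => gsat_ex_teamAtom hv hX (hJ.trans hI) ht)
        (fun J Y => ih h₁ (i + 1) J Y) (update_mem_agreeing (hX hs) hv m)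
    rw [forall₂_congr key]
    constructor
    · intro hsat s hs m
      refine ⟨dupTeam M X v, ?_, ⟨s, hs, m, rfl⟩, Set.Subset.rfl, hsat⟩
      rintro _ ⟨t, ht, m, rfl⟩
      exact update_mem_agreeing (hX ht) hv m
    · intro h
      change teamSat M φ (dupTeam M X v)
      convert teamSat_sUnion φ {Y | Y ⊆ dupTeam M X v ∧ teamSat M φ Y} fun Y hY => hY.2 using 1
      refine Set.Subset.antisymm ?_ (Set.sUnion_subset fun Y hY => hY.1)
      rintro _ ⟨s, hs, m, rfl⟩
      obtain ⟨Y, -, hm, hY⟩ := h s hs m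
      exact ⟨Y, hY, hm⟩

end Correctness

/-! ### Sentences -/

/-- The PGFP formula saying that the translated formula holds of the team consisting only of the
tuple `z̄ = (x_N, …, x_{2N-1})`. -/
def singletonGFP (N : ℕ) (φ : IncForm L) : GFPForm L :=
  .gfp 0 N (fun j => (j : ℕ))
    (conjEqs (fun j : Fin N => Term.var (j : ℕ)) (fun j => Term.var (j + N)) (toGFP N 0 φ)
      (List.finRange N))
    fun j => Term.var (j + N)

lemma fvG_singletonGFP (N : ℕ) (φ : IncForm L) (hφ : avInc φ ⊆ Set.Iio N) :
    fvG (singletonGFP N φ) ⊆ {v | v ∈ List.range' N N} := by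
  have hz : ∀ j : Fin N, tvars (Term.var (j + N) : L.Term ℕ) ⊆ {v | v ∈ List.range' N N} := by
    rintro j _ rfl
    simp [List.mem_range'_1]
  refine Set.union_subset (Set.iUnion_subset hz) ?_
  have hr : (Set.range fun j : Fin N => (j : ℕ)) = Set.Iio N := by
    ext v
    exact ⟨by rintro ⟨j, rfl⟩; exact j.2, fun hv => ⟨⟨v, hv⟩, rfl⟩⟩
  rw [hr, Set.sdiff_subset_iff]
  refine fvG_conjEqs_subset ?_ (fun j v hv => Or.inr (hz j hv))
    (fun v hv => Or.inl (fvG_toGFP N 0 φ hφ hv)) _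
  rintro j _ rfl
  exact Or.inl j.2

lemma gsat_singletonGFP {M : Type*} [L.Structure M] (N : ℕ) (φ : IncForm L)
    (hφ : avInc φ ⊆ Set.Iio N) (I : RelInterp M) {s s₀ : ℕ → M}
    (h : ∀ v < N, s (v + N) = s₀ v) :
    gsat M (singletonGFP N φ) I s ↔ teamSat M φ {s₀} := by
  have hrel : teamRel N {s₀} = {fun j : Fin N => s₀ j} := by
    ext a
    simp [teamRel]
  have hz : (fun j : Fin N => s (j + N)) = fun j : Fin N => s₀ j := funext fun j => h j j.2
  have hsat : teamSat M φ {s₀} ↔ gsat M (toGFP N 0 φ) (updI I N 0 {fun j : Fin N => s₀ j})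
      (updVec s (fun j : Fin N => (j : ℕ)) fun j : Fin N => s₀ j) := by
    rw [teamSat_iff_gsat N s₀ φ hφ 0 _ {s₀} (by rintro _ rfl v _; rfl)
      ((updI_self I N 0 _).trans hrel.symm)]
    simp only [Set.mem_singleton_iff, forall_eq]
    refine gsat_congr _ _ fun v hv => ?_
    rw [updVec_of_lt _ (fvG_toGFP N 0 φ hφ hv)]
  rw [hsat]
  simp only [singletonGFP, gsat, gsat_conjEqs, Term.realize_var, hz]
  constructor
  · rintro ⟨Q, hQ, hmem⟩
    obtain rfl : Q = {fun j : Fin N => s₀ j} := by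
      refine Set.eq_singleton_iff_unique_mem.2 ⟨hmem, fun a ha => funext fun j => ?_⟩
      have := (hQ ha).1 j (List.mem_finRange j)
      rwa [updVec_of_lt _ j.2, updVec_of_le _ (Nat.le_add_left N j), h j j.2] at this
    exact (hQ hmem).2
  · intro hg
    refine ⟨{fun j : Fin N => s₀ j}, ?_, rfl⟩
    rintro _ rfl
    refine ⟨fun j _ => ?_, hg⟩
    rw [updVec_of_lt _ j.2, updVec_of_le _ (Nat.le_add_left N j), h j j.2]

end TeamSem

open TeamSem in
/-- half of Corollary `incgfpeq`: for every inclusion logic sentence `φ`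
there is a PGFP sentence `θ` over the same signature such that for all structures `M`:
`M ⊨ φ` iff `M ⊨ θ`. -/
theorem inc_sentence_to_gfp_sentence {L : Language} (φ : IncForm L) (hφ : fvInc φ = ∅) :
    ∃ θ : GFPForm L, fvG θ = ∅ ∧ rvG θ = ∅ ∧
      ∀ (M : Type*) [L.Structure M] [Nonempty M],
        incTrue M φ ↔ ∀ s : ℕ → M, gsat M θ (botI M) s := by
  obtain ⟨B, hB⟩ := (finite_avInc φ).bddAbove
  have hN : avInc φ ⊆ Set.Iio (B + 1) := fun v hv => Nat.lt_succ_of_le (hB hv)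
  refine ⟨alls (List.range' (B + 1) (B + 1)) (singletonGFP (B + 1) φ), ?_, ?_, ?_⟩
  · rw [fvG_alls]
    exact Set.sdiff_eq_empty.2 (fvG_singletonGFP _ φ hN)
  · rw [rvG_alls]
    change rvG (conjEqs _ _ _ _) \ _ = ∅
    rw [rvG_conjEqs]
    exact Set.sdiff_eq_empty.2 (rvG_toGFP _ 0 φ)
  · intro M _ _
    rw [gsat_alls]
    constructor
    · exact fun h s =>
        (gsat_singletonGFP (B + 1) φ hN _ (s₀ := fun v => s (v + (B + 1))) fun _ _ => rfl).2 (h _)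
    · exact fun h s₀ => (gsat_singletonGFP (B + 1) φ hN _
        (s := fun v => s₀ (v - (B + 1))) fun v _ => by simp).1 (h _)
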